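/- The matrices diag(ζ,1,1), diag(1,ζ,1), and (1/3)·[[2+ζ, −1−2ζ, 2+ζ],[2+ζ, 2+ζ, −1−2ζ],[−1−2ζ, 2+ζ, 2+ζ]] (where ζ = e^{2πi/3}) generate a finite subgroup of GL(3,ℂ) of order 648. -/

import Mathlib

open Matrix Complex

namespace G25

/-- The field `ℚ(ω)` with `ω² = -1 - ω`, a computable model of the third cyclotomic field. -/
abbrev CycField : Type := QuadraticAlgebra ℚ (-1) (-1)

/-- The primitive third root of unity in `CycField`. -/
abbrev root : CycField := ⟨0, 1⟩

/-- `3 × 3` matrices over `CycField`. -/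
abbrev Mat : Type := Matrix (Fin 3) (Fin 3) CycField

/-- The first diagonal reflection. -/
def refl₁ : Mat := diagonal ![root, 1, 1]

/-- The second diagonal reflection. -/
def refl₂ : Mat := diagonal ![1, root, 1]

/-- The circulant reflection, with entries `(2 + ω) / 3` and `(-1 - 2ω) / 3`. -/
def refl₃ : Mat :=
  !![⟨2 / 3, 1 / 3⟩, ⟨-1 / 3, -2 / 3⟩, ⟨2 / 3, 1 / 3⟩;
     ⟨2 / 3, 1 / 3⟩, ⟨2 / 3, 1 / 3⟩, ⟨-1 / 3, -2 / 3⟩;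
     ⟨-1 / 3, -2 / 3⟩, ⟨2 / 3, 1 / 3⟩, ⟨2 / 3, 1 / 3⟩]

/-- The monoid generated by the three reflections. -/
def reflMonoid : Submonoid Mat := Submonoid.closure {refl₁, refl₂, refl₃}

/-- The monomial matrix of the permutation `σ`, with sign `sign σ` and column phases `ω ^ u c`. -/
def mono (σ : Equiv.Perm (Fin 3)) (u : Fin 3 → ZMod 3) : Mat :=
  of fun r c => if r = σ c then ((Equiv.Perm.sign σ : ℤ) : CycField) * root ^ (u c).val else 0

/-- Representatives of the left cosets of the monomial matrices. -/
def rep : Fin 4 → Mat := ![1, refl₃, refl₁ * refl₃, refl₁ * (refl₁ * refl₃)]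

/-- The normal form of a group element: a coset representative times a monomial matrix. -/
def normalForm (x : Fin 4 × Equiv.Perm (Fin 3) × (Fin 3 → ZMod 3)) : Mat :=
  rep x.1 * mono x.2.1 x.2.2

theorem root_pow_add_val :
    ∀ a b : ZMod 3, root ^ (a + b).val = root ^ a.val * root ^ b.val := by
  decide +kernel

theorem mono_mul (σ τ : Equiv.Perm (Fin 3)) (u v : Fin 3 → ZMod 3) :
    mono σ u * mono τ v = mono (σ * τ) (fun c => u (τ c) + v c) := by
  ext1 r c
  rw [mul_apply, Finset.sum_eq_single (τ c)]
  · simp only [mono, of_apply, Equiv.Perm.mul_apply, if_true, root_pow_add_val,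
      Equiv.Perm.sign_mul, Units.val_mul, Int.cast_mul]
    split_ifs
    · ring
    · simp
  · intro b _ hb
    simp [mono, hb]
  · simp

theorem mono_one_zero : mono 1 0 = 1 := by decide +kernel

theorem refl₁_mul_rep : ∀ k, ∃ k' σ u, refl₁ * rep k = rep k' * mono σ u := by decide +kernel

theorem refl₂_mul_rep : ∀ k, ∃ k' σ u, refl₂ * rep k = rep k' * mono σ u := by decide +kernel

theorem refl₃_mul_rep : ∀ k, ∃ k' σ u, refl₃ * rep k = rep k' * mono σ u := by decide +kernel

theorem rep_mul_mono_eq_rep :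
    ∀ k k' σ u, rep k * mono σ u = rep k' → k = k' ∧ σ = 1 ∧ u = 0 := by
  decide +kernel

theorem normalForm_injective : Function.Injective normalForm := by
  rintro ⟨k, σ, u⟩ ⟨k', σ', u'⟩ h
  have h' := congrArg (· * mono σ'⁻¹ (fun c => -u' (σ'⁻¹ c))) h
  simp only [normalForm, mul_assoc, mono_mul, mul_inv_cancel, add_neg_cancel] at h'
  have h1 : mono 1 (fun _ => 0) = 1 := mono_one_zero
  rw [h1, mul_one] at h'
  obtain ⟨hk, hσ, hu⟩ := rep_mul_mono_eq_rep _ _ _ _ h'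
  have hu' : u = u' := by
    funext c
    have := congrFun hu (σ' c)
    simpa [add_neg_eq_zero] using this
  rw [hk, hu', mul_inv_eq_one.mp hσ]

theorem refl₁_mem : refl₁ ∈ reflMonoid := Submonoid.subset_closure (by simp)

theorem refl₂_mem : refl₂ ∈ reflMonoid := Submonoid.subset_closure (by simp)

theorem refl₃_mem : refl₃ ∈ reflMonoid := Submonoid.subset_closure (by simp)

theorem mul_normalForm_mem_range {s : Mat}
    (hs : ∀ k, ∃ k' σ u, s * rep k = rep k' * mono σ u) {x : Mat}
    (hx : x ∈ Set.range normalForm) : s * x ∈ Set.range normalForm := by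
  obtain ⟨⟨k, τ, v⟩, rfl⟩ := hx
  obtain ⟨k', σ, u, h⟩ := hs k
  refine ⟨⟨k', σ * τ, fun c => u (τ c) + v c⟩, ?_⟩
  simp only [normalForm]
  rw [← mul_assoc, h, mul_assoc, mono_mul]

theorem reflMonoid_subset_range : (reflMonoid : Set Mat) ⊆ Set.range normalForm := by
  intro x hx
  induction hx using Submonoid.closure_induction_left with
  | one => exact ⟨⟨0, 1, 0⟩, by simp [normalForm, rep, mono_one_zero]⟩
  | mul_left s hs y _ ih =>
    rcases hs with rfl | rfl | rfl
    · exact mul_normalForm_mem_range refl₁_mul_rep ih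
    · exact mul_normalForm_mem_range refl₂_mul_rep ih
    · exact mul_normalForm_mem_range refl₃_mul_rep ih

theorem mono_swap_one_two_eq :
    mono (Equiv.swap 1 2) ![1, 2, 1] = refl₃ * (rep 3) := by decide +kernel

theorem mono_swap_zero_one_eq :
    mono (Equiv.swap 0 1) ![1, 2, 2] = refl₂ * (refl₃ * (refl₁ * (refl₂ * refl₃))) := by
  decide +kernel

theorem mono_one_eq :
    ∀ u, mono 1 u = refl₁ ^ (u 0).val * refl₂ ^ (u 1).val *
      (mono (Equiv.swap 1 2) ![1, 2, 1] * (refl₂ * (refl₁ *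
        mono (Equiv.swap 1 2) ![1, 2, 1]))) ^ (u 2).val := by
  decide +kernel

theorem rep_mem : ∀ k, rep k ∈ reflMonoid := by
  have h := mul_mem refl₁_mem refl₃_mem
  intro k
  fin_cases k
  exacts [one_mem _, refl₃_mem, h, mul_mem refl₁_mem h]

theorem mono_one_mem (u : Fin 3 → ZMod 3) : mono 1 u ∈ reflMonoid := by
  have h : mono (Equiv.swap 1 2) ![1, 2, 1] ∈ reflMonoid :=
    mono_swap_one_two_eq ▸ mul_mem refl₃_mem (rep_mem 3)
  rw [mono_one_eq]
  exact mul_mem (mul_mem (pow_mem refl₁_mem _) (pow_mem refl₂_mem _))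
    (pow_mem (mul_mem h (mul_mem refl₂_mem (mul_mem refl₁_mem h))) _)

theorem mono_mem_of_mono_mem {σ : Equiv.Perm (Fin 3)} {u : Fin 3 → ZMod 3}
    (h : mono σ u ∈ reflMonoid) (v : Fin 3 → ZMod 3) : mono σ v ∈ reflMonoid := by
  have := mul_mem h (mono_one_mem (v - u))
  rw [mono_mul] at this
  simpa using this

/-- Signed permutation matrices, as a homomorphism. -/
def permHom : Equiv.Perm (Fin 3) →* Mat where
  toFun σ := mono σ 0
  map_one' := mono_one_zero
  map_mul' σ τ := by
    rw [mono_mul]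
    congr 1

theorem perm_eq_pow_swap_mul : ∀ σ : Equiv.Perm (Fin 3), ∃ i j k : Fin 2,
    σ = Equiv.swap 0 1 ^ i.val * Equiv.swap 1 2 ^ j.val * Equiv.swap 0 1 ^ k.val := by
  decide +kernel

theorem mono_mem (σ : Equiv.Perm (Fin 3)) (u : Fin 3 → ZMod 3) : mono σ u ∈ reflMonoid := by
  have h₁ : Equiv.swap 0 1 ∈ reflMonoid.comap permHom :=
    mono_mem_of_mono_mem (mono_swap_zero_one_eq ▸ mul_mem refl₂_mem (mul_mem refl₃_mem
      (mul_mem refl₁_mem (mul_mem refl₂_mem refl₃_mem)))) 0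
  have h₂ : Equiv.swap 1 2 ∈ reflMonoid.comap permHom :=
    mono_mem_of_mono_mem (mono_swap_one_two_eq ▸ mul_mem refl₃_mem (rep_mem 3)) 0
  have h : σ ∈ reflMonoid.comap permHom := by
    obtain ⟨i, j, k, rfl⟩ := perm_eq_pow_swap_mul σ
    exact mul_mem (mul_mem (pow_mem h₁ _) (pow_mem h₂ _)) (pow_mem h₁ _)
  exact mono_mem_of_mono_mem h u

theorem coe_reflMonoid : (reflMonoid : Set Mat) = Set.range normalForm := by
  refine reflMonoid_subset_range.antisymm ?_
  rintro _ ⟨x, rfl⟩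
  exact mul_mem (rep_mem _) (mono_mem _ _)

theorem card_reflMonoid : Nat.card reflMonoid = 648 := by
  have h : Nat.card reflMonoid = Nat.card (Set.range normalForm) := by
    rw [← coe_reflMonoid]
    rfl
  rw [h, Nat.card_range_of_injective normalForm_injective]
  simp [Nat.card_eq_fintype_card, Fintype.card_perm, Nat.factorial]

instance : Fact (∀ r : ℚ, r ^ 2 ≠ -1 + -1 * r) :=
  ⟨fun r h => by nlinarith [sq_nonneg (r + 1 / 2)]⟩

/-- The embedding of `CycField` into `ℂ` sending `ω` to a root `ζ` of `X² + X + 1`. -/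
noncomputable def embed (ζ : ℂ) (h : ζ * ζ = -1 - ζ) : CycField →ₐ[ℚ] ℂ :=
  QuadraticAlgebra.lift ⟨ζ, by rw [h, neg_one_smul, neg_one_smul, sub_eq_add_neg]⟩

theorem embed_mk (ζ : ℂ) (h : ζ * ζ = -1 - ζ) (x y : ℚ) :
    embed ζ h ⟨x, y⟩ = x + y * ζ := by
  change x • (1 : ℂ) + y • ζ = x + y * ζ
  simp [Algebra.smul_def]

end G25


/-- With `ζ = e^{2πi/3}`, the matrices `diag(ζ,1,1)`, `diag(1,ζ,1)` and
`(1/3)·[[2+ζ, −1−2ζ, 2+ζ],[2+ζ, 2+ζ, −1−2ζ],[−1−2ζ, 2+ζ, 2+ζ]]` generate a finite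
group of order 648 (the Shephard–Todd group `G₂₅`); since these matrices generate a
finite group, the multiplicative closure they generate is this group, and it has
cardinality 648. -/
theorem shephard_todd_G25_order :
    ∀ ζ : ℂ, ζ = Complex.exp (2 * Real.pi * Complex.I / 3) →
    Nat.card (Submonoid.closure
      ({Matrix.diagonal ![ζ, 1, 1],
        Matrix.diagonal ![1, ζ, 1],
        (1 / 3 : ℂ) • !![2 + ζ, -1 - 2*ζ, 2 + ζ;
                         2 + ζ, 2 + ζ, -1 - 2*ζ;
                         -1 - 2*ζ, 2 + ζ, 2 + ζ]} :
        Set (Matrix (Fin 3) (Fin 3) ℂ))) = 648 := by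
  intro ζ hζ
  have hprim : IsPrimitiveRoot ζ 3 := by
    rw [hζ]
    exact_mod_cast Complex.isPrimitiveRoot_exp 3 (by norm_num)
  have hsq : ζ * ζ = -1 - ζ := by
    have h := hprim.geom_sum_eq_zero (by norm_num)
    simp only [Finset.sum_range_succ, Finset.sum_range_zero] at h
    linear_combination h
  set φ := G25.embed ζ hsq
  let Φ : G25.Mat →* Matrix (Fin 3) (Fin 3) ℂ := (φ.toRingHom.mapMatrix : G25.Mat →+* _)
  have hΦ : Function.Injective Φ := Matrix.map_injective φ.toRingHom.injective
  have hr : φ G25.root = ζ := by simp [φ, G25.embed_mk]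
  have h₁ : Φ G25.refl₁ = diagonal ![ζ, 1, 1] := by
    change (diagonal ![G25.root, 1, 1]).map φ = _
    rw [diagonal_map (map_zero φ)]
    congr 1
    ext i
    fin_cases i <;> simp [hr]
  have h₂ : Φ G25.refl₂ = diagonal ![1, ζ, 1] := by
    change (diagonal ![1, G25.root, 1]).map φ = _
    rw [diagonal_map (map_zero φ)]
    congr 1
    ext i
    fin_cases i <;> simp [hr]
  have h₃ : Φ G25.refl₃ = (1 / 3 : ℂ) • !![2 + ζ, -1 - 2*ζ, 2 + ζ;
      2 + ζ, 2 + ζ, -1 - 2*ζ; -1 - 2*ζ, 2 + ζ, 2 + ζ] := by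
    change G25.refl₃.map φ = _
    ext i j
    fin_cases i <;> fin_cases j <;> simp [G25.refl₃, φ, G25.embed_mk] <;> ring
  rw [← G25.card_reflMonoid, Nat.card_congr
    (G25.reflMonoid.equivMapOfInjective Φ hΦ).toEquiv, G25.reflMonoid, MonoidHom.map_mclosure,
    Set.image_insert_eq, Set.image_insert_eq, Set.image_singleton, h₁, h₂, h₃]
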